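/- arXiv:2302.00524 — 11 statements merged into one kernel-verified Lean document; each statement's English description precedes it below -/
import Mathlib

section
/- Let α ≥ 1 and let f : ℝ → ℝ be a twice differentiable function satisfying f''(t) = −α |f(t)|^{2(α−1)} f(t) for all t, with f(0) = 0 and f'(0) = 1. Then f is periodic with period 2π_α, where π_α := 2 ∫₀¹ (1 − t^{2α})^{−1/2} dt; that is, f(t + 2π_α) = f(t) for all t ∈ ℝ. -/
open Topology in
theorem hasDerivAt_abs_rpow_mul_self {p : ℝ} (hp : 0 ≤ p) (x : ℝ) :
    HasDerivAt (fun x : ℝ => |x| ^ p * x) ((p + 1) * |x| ^ p) x := by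
  rcases eq_or_ne x 0 with rfl | hx
  · rcases hp.eq_or_lt with rfl | hp
    · simpa using hasDerivAt_id' (0 : ℝ)
    · rw [hasDerivAt_iff_tendsto_slope_zero]
      have hc : Continuous fun t : ℝ => |t| ^ p := continuous_abs.rpow_const fun _ => Or.inr hp.le
      have ht := (hc.tendsto 0).mono_left (nhdsWithin_le_nhds (s := {0}ᶜ))
      rw [show (p + 1) * |(0 : ℝ)| ^ p = |(0 : ℝ)| ^ p by simp [hp.ne']]
      refine ht.congr' ?_
      filter_upwards [self_mem_nhdsWithin] with t ht
      have ht : t ≠ 0 := ht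
      simp only [zero_add, mul_zero, sub_zero, smul_eq_mul]
      field_simp
  · have hpow (y : ℝ) (hy : y ≠ 0) : |y| ^ (p + 2) = |y| ^ p * y ^ 2 := by
      rw [Real.rpow_add (abs_pos.2 hy)]
      simp
    have hq := (hasDerivAt_abs_rpow x (p := p + 2) (by linarith)).div (hasDerivAt_id x) hx
    have he : (fun x : ℝ => |x| ^ p * x) =ᶠ[𝓝 x] (fun x : ℝ => |x| ^ (p + 2)) / id := by
      filter_upwards [isOpen_ne.mem_nhds hx] with y hy
      have hy : y ≠ 0 := hy
      simp only [Pi.div_apply, id, hpow y hy]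
      field_simp
    refine (hq.congr_of_eventuallyEq he).congr_deriv ?_
    simp only [id, hpow x hx, add_sub_cancel_right]
    field_simp
    ring

open Set in
theorem lipschitzOnWith_alpha_sine_field {p : ℝ} (hp : 0 ≤ p) (α : ℝ) :
    ∃ K, LipschitzOnWith K (fun z : ℝ × ℝ => (z.2, -α * |z.1| ^ p * z.1)) {z | |z.1| ≤ 1} := by
  have hl : LipschitzOnWith (Real.toNNReal (|α| * (p + 1))) (fun x : ℝ => -α * |x| ^ p * x)
      (Icc (-1) 1) := by
    refine (convex_Icc (-1 : ℝ) 1).lipschitzOnWith_of_nnnorm_hasDerivWithin_le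
      (f' := fun x => -α * ((p + 1) * |x| ^ p)) (fun x _ => ?_) fun x hx => ?_
    · simpa only [mul_assoc] using
        ((hasDerivAt_abs_rpow_mul_self hp x).const_mul (-α)).hasDerivWithinAt
    · rw [← NNReal.coe_le_coe, Real.coe_toNNReal _ (by positivity), coe_nnnorm, norm_mul,
        norm_neg, Real.norm_eq_abs, Real.norm_of_nonneg (by positivity)]
      have := Real.rpow_le_one (abs_nonneg x) (abs_le.2 hx) hp
      gcongr
      exact mul_le_of_le_one_right (by positivity) this
  have hc := hl.comp (LipschitzWith.prod_fst.lipschitzOnWith (s := {z : ℝ × ℝ | |z.1| ≤ 1}))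
    fun z hz => abs_le.1 hz
  exact ⟨_, LipschitzWith.prod_snd.lipschitzOnWith.prodMk hc⟩

theorem alpha_sine_unique {α p : ℝ} (hp : 0 ≤ p) {f f' g g' : ℝ → ℝ}
    (hf : ∀ t, HasDerivAt f (f' t) t) (hf' : ∀ t, HasDerivAt f' (-α * |f t| ^ p * f t) t)
    (hg : ∀ t, HasDerivAt g (g' t) t) (hg' : ∀ t, HasDerivAt g' (-α * |g t| ^ p * g t) t)
    (hfb : ∀ t, |f t| ≤ 1) (hgb : ∀ t, |g t| ≤ 1) (h0 : f 0 = g 0) (h1 : f' 0 = g' 0) :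
    f = g := by
  obtain ⟨K, hK⟩ := lipschitzOnWith_alpha_sine_field hp α
  have h := ODE_solution_unique_univ (t₀ := 0) (f := fun t => (f t, f' t))
    (g := fun t => (g t, g' t)) (fun _ => hK) (fun t => ⟨(hf t).prodMk (hf' t), hfb t⟩)
    (fun t => ⟨(hg t).prodMk (hg' t), hgb t⟩) (by simp [h0, h1])
  exact funext fun t => congrArg Prod.fst (congrFun h t)

theorem alpha_sine_energy {α : ℝ} (hα : 1 ≤ α) {f f' : ℝ → ℝ}
    (hf : ∀ t, HasDerivAt f (f' t) t)
    (hf' : ∀ t, HasDerivAt f' (-α * |f t| ^ (2 * (α - 1)) * f t) t)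
    (h0 : f 0 = 0) (h1 : f' 0 = 1) (t : ℝ) : f' t ^ 2 + |f t| ^ (2 * α) = 1 := by
  have hd (t : ℝ) : HasDerivAt (fun t => f' t ^ 2 + |f t| ^ (2 * α)) 0 t := by
    have h := ((hf' t).pow 2).add
      ((hasDerivAt_abs_rpow (f t) (p := 2 * α) (by linarith)).comp t (hf t))
    refine h.congr_deriv ?_
    rw [show 2 * α - 2 = 2 * (α - 1) by ring]
    push_cast
    ring
  have hc := is_const_of_deriv_eq_zero (fun t => (hd t).differentiableAt)
    (fun t => (hd t).deriv) t 0
  simpa [h0, h1, Real.zero_rpow (show 2 * α ≠ 0 by linarith)] using hc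

theorem alpha_sine_abs_le_one {α : ℝ} (hα : 1 ≤ α) {f f' : ℝ → ℝ}
    (hf : ∀ t, HasDerivAt f (f' t) t)
    (hf' : ∀ t, HasDerivAt f' (-α * |f t| ^ (2 * (α - 1)) * f t) t)
    (h0 : f 0 = 0) (h1 : f' 0 = 1) (t : ℝ) : |f t| ≤ 1 := by
  by_contra! h
  have := Real.one_lt_rpow h (show 0 < 2 * α by linarith)
  nlinarith [alpha_sine_energy hα hf hf' h0 h1 t, sq_nonneg (f' t)]

open Set in
theorem exists_nonneg_alpha_sine_deriv_nonpos {α p : ℝ} (hα : 1 ≤ α) (hp : 0 ≤ p) {f f' : ℝ → ℝ}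
    (hf : ∀ t, HasDerivAt f (f' t) t) (hf' : ∀ t, HasDerivAt f' (-α * |f t| ^ p * f t) t)
    (h0 : f 0 = 0) : ∃ t, 0 ≤ t ∧ f' t ≤ 0 := by
  by_contra! hpos
  have hmono : StrictMonoOn f (Ici 0) := by
    refine strictMonoOn_of_deriv_pos (convex_Ici 0)
      (fun t _ => (hf t).continuousAt.continuousWithinAt) fun t ht => ?_
    rw [(hf t).deriv]
    exact hpos t (interior_subset ht)
  have hc : 0 < f 1 := h0 ▸ hmono self_mem_Ici (show (0 : ℝ) ≤ 1 by norm_num) one_pos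
  set k := f 1 ^ p * f 1 with hk
  have hk0 : 0 < k := by positivity
  have hd (t : ℝ) : HasDerivAt (fun t => f' t + k * t) (-α * |f t| ^ p * f t + k) t := by
    simpa using (hf' t).fun_add ((hasDerivAt_id' t).const_mul k)
  have hanti : AntitoneOn (fun t => f' t + k * t) (Ici 1) := by
    refine antitoneOn_of_deriv_nonpos (convex_Ici 1)
      (fun t _ => (hd t).continuousAt.continuousWithinAt)
      (fun t _ => (hd t).differentiableAt.differentiableWithinAt) fun t ht => ?_
    have ht1 : (1 : ℝ) ≤ t := interior_subset ht
    have hle : f 1 ≤ f t := hmono.monotoneOn (show (0 : ℝ) ≤ 1 by norm_num)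
      (show (0 : ℝ) ≤ t by linarith) ht1
    rw [(hd t).deriv, abs_of_pos (hc.trans_le hle)]
    have hft := hc.trans_le hle
    have : k ≤ f t ^ p * f t := by rw [hk]; gcongr
    nlinarith
  have hq : 0 < f' 1 / k := div_pos (hpos 1 one_pos.le) hk0
  have hle := hanti self_mem_Ici (show (1 : ℝ) ≤ 1 + f' 1 / k by linarith) (by linarith)
  simp only [mul_add, mul_div_cancel₀ _ hk0.ne'] at hle
  linarith [hpos (1 + f' 1 / k) (by linarith)]

open Set in
theorem exists_first_zero_alpha_sine_deriv {α p : ℝ} (hα : 1 ≤ α) (hp : 0 ≤ p) {f f' : ℝ → ℝ}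
    (hf : ∀ t, HasDerivAt f (f' t) t) (hf' : ∀ t, HasDerivAt f' (-α * |f t| ^ p * f t) t)
    (h0 : f 0 = 0) (h1 : f' 0 = 1) :
    ∃ T, 0 < T ∧ f' T = 0 ∧ ∀ t ∈ Ico 0 T, 0 < f' t := by
  have hcont : Continuous f' := continuous_iff_continuousAt.2 fun t => (hf' t).continuousAt
  let S : Set ℝ := {t | 0 ≤ t ∧ f' t ≤ 0}
  have hS : IsClosed S := (isClosed_le continuous_const continuous_id).inter
    (isClosed_le hcont continuous_const)
  have hb : BddBelow S := ⟨0, fun t ht => ht.1⟩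
  obtain ⟨hT0, hT⟩ := hS.csInf_mem (exists_nonneg_alpha_sine_deriv_nonpos hα hp hf hf' h0) hb
  have hlt (t : ℝ) (ht : t ∈ Ico 0 (sInf S)) : 0 < f' t :=
    not_le.1 fun h => (csInf_le hb ⟨ht.1, h⟩).not_gt ht.2
  obtain ⟨c, hc, hc0⟩ := intermediate_value_Icc' hT0 hcont.continuousOn
    (show (0 : ℝ) ∈ Icc (f' (sInf S)) (f' 0) from ⟨hT, by simp [h1]⟩)
  have hcT : c = sInf S := le_antisymm hc.2 (csInf_le hb ⟨hc.1, hc0.le⟩)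
  refine ⟨sInf S, hT0.lt_of_ne ?_, hcT ▸ hc0, hlt⟩
  intro h
  rw [← h, h1] at hT
  norm_num at hT

open Set MeasureTheory in
/-- The quarter period: the first zero of the derivative of the α-sine function. -/
theorem alpha_sine_quarter_period {α : ℝ} (hα : 1 ≤ α) {f f' : ℝ → ℝ}
    (hf : ∀ t, HasDerivAt f (f' t) t)
    (hf' : ∀ t, HasDerivAt f' (-α * |f t| ^ (2 * (α - 1)) * f t) t)
    (h0 : f 0 = 0) (h1 : f' 0 = 1) :
    f' (∫ t in (0:ℝ)..1, (1 - t ^ (2 * α)) ^ (-(1:ℝ) / 2)) = 0 := by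
  obtain ⟨T, hT, hT0, hpos⟩ :=
    exists_first_zero_alpha_sine_deriv hα (by linarith : 0 ≤ 2 * (α - 1)) hf hf' h0 h1
  suffices (∫ t in (0:ℝ)..1, (1 - t ^ (2 * α)) ^ (-(1:ℝ) / 2)) = T by rwa [this]
  have hcont : ContinuousOn f (Icc 0 T) := fun t _ => (hf t).continuousAt.continuousWithinAt
  have hmono : StrictMonoOn f (Icc 0 T) := by
    refine strictMonoOn_of_deriv_pos (convex_Icc 0 T) hcont fun t ht => ?_
    rw [interior_Icc] at ht
    exact (hf t).deriv ▸ hpos t ⟨ht.1.le, ht.2⟩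
  have hfpos {t : ℝ} (ht : t ∈ Ioc 0 T) : 0 < f t :=
    h0 ▸ hmono (left_mem_Icc.2 hT.le) (Ioc_subset_Icc_self ht) ht.1
  have hfT : f T = 1 := by
    have h := alpha_sine_energy hα hf hf' h0 h1 T
    have hp := hfpos (right_mem_Ioc.2 hT)
    rw [hT0, abs_of_pos hp] at h
    exact (Real.rpow_left_inj hp.le zero_le_one (show 2 * α ≠ 0 by linarith)).1 (by simpa using h)
  have himage : f '' Ioo 0 T = Ioo 0 1 := by
    refine Subset.antisymm ?_ ?_
    · rintro _ ⟨t, ht, rfl⟩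
      exact ⟨hfpos (Ioo_subset_Ioc_self ht),
        hfT ▸ hmono (Ioo_subset_Icc_self ht) (right_mem_Icc.2 hT.le) ht.2⟩
    · simpa [h0, hfT] using intermediate_value_Ioo hT.le hcont
  rw [intervalIntegral.integral_of_le zero_le_one, integral_Ioc_eq_integral_Ioo, ← himage,
    integral_image_eq_integral_abs_deriv_smul measurableSet_Ioo
      (fun t _ => (hf t).hasDerivWithinAt) (hmono.injOn.mono Ioo_subset_Icc_self)]
  have hone : ∀ t ∈ Ioo 0 T, |f' t| • (1 - f t ^ (2 * α)) ^ (-(1:ℝ) / 2) = 1 := by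
    intro t ht
    have hp := hpos t ⟨ht.1.le, ht.2⟩
    have he := alpha_sine_energy hα hf hf' h0 h1 t
    rw [abs_of_pos (hfpos (Ioo_subset_Ioc_self ht))] at he
    rw [show 1 - f t ^ (2 * α) = f' t ^ (2 : ℝ) by rw [Real.rpow_two]; linarith,
      ← Real.rpow_mul hp.le, abs_of_pos hp]
    norm_num [Real.rpow_neg_one, hp.ne']
  rw [setIntegral_congr_fun measurableSet_Ioo hone]
  simp [hT.le]


/-- The α-sine function is periodic with period `2 π_α`, where
`π_α = 2 ∫₀¹ (1 - t^(2α))^(-1/2) dt`. -/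
theorem alpha_sine_periodic (α : ℝ) (hα : 1 ≤ α) (f f' : ℝ → ℝ)
    (hf : ∀ t, HasDerivAt f (f' t) t)
    (hf' : ∀ t, HasDerivAt f' (-α * |f t| ^ (2 * (α - 1)) * f t) t)
    (h0 : f 0 = 0) (h1 : f' 0 = 1)
    (πα : ℝ) (hπα : πα = 2 * ∫ t in (0:ℝ)..1, (1 - t ^ (2 * α)) ^ (-(1:ℝ) / 2)) :
    ∀ t : ℝ, f (t + 2 * πα) = f t := by
  have hp : 0 ≤ 2 * (α - 1) := by linarith
  have hb := alpha_sine_abs_le_one hα hf hf' h0 h1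
  have hT := alpha_sine_quarter_period hα hf hf' h0 h1
  rw [hπα]
  set T := ∫ t in (0:ℝ)..1, (1 - t ^ (2 * α)) ^ (-(1:ℝ) / 2)
  have hodd : f = fun t => -f (0 - t) := by
    refine alpha_sine_unique hp hf hf' (g' := fun t => f' (0 - t))
      (fun t => ?_) (fun t => ?_) hb (fun t => ?_) (by simp [h0]) (by simp)
    · simpa using ((hf (0 - t)).comp_const_sub 0 t).fun_neg
    · simpa using (hf' (0 - t)).comp_const_sub 0 t
    · simpa using hb (0 - t)
  have hrefl : (fun t => f (T + t)) = fun t => f (T - t) :=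
    alpha_sine_unique hp (fun t => (hf (T + t)).comp_const_add T t)
      (fun t => (hf' (T + t)).comp_const_add T t)
      (fun t => (hf (T - t)).comp_const_sub T t)
      (fun t => by simpa using ((hf' (T - t)).comp_const_sub T t).fun_neg)
      (fun t => hb (T + t)) (fun t => hb (T - t)) (by simp) (by simp [hT])
  have hhalf (t : ℝ) : f (t + 2 * T) = -f t := by
    have h := congrFun hrefl (T + t)
    have h' := congrFun hodd t
    simp only [zero_sub] at h'
    rw [h', neg_neg]
    convert h using 2 <;> ring
  intro t
  rw [show t + 2 * (2 * T) = t + 2 * T + 2 * T by ring, hhalf, hhalf, neg_neg]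
end

section
/- Fix α ≥ 1 and v₀ ∈ ℝ with v₀ ≠ 0, and let u, x : ℝ → ℝ be differentiable functions satisfying x'(t) = u(t) and u'(t) = −α v₀² |x(t)|^{2(α−1)} x(t) for all t. Set 2H := u(0)² + v₀² |x(0)|^{2α} and, for y₀ ∈ ℝ, define y(t) := y₀ + (2H·t + u(0)x(0) − u(t)x(t)) / (v₀(α+1)). Then y'(t) = v₀ |x(t)|^{2α} for all t ∈ ℝ; consequently (u(t), v₀, x(t), y(t)) solves the full Hamiltonian system of the α-Grushin plane: u' = −α v₀² |x|^{2(α−1)} x, v' = 0, x' = u, y' = v₀ |x|^{2α}. -/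
/-- The energy `u² + v₀² |x|^(2α)` is conserved along α-Grushin geodesics. -/
theorem alpha_grushin_energy_eq (α : ℝ) (hα : 1 ≤ α) (v₀ : ℝ) (u x : ℝ → ℝ)
    (hx : ∀ t, HasDerivAt x (u t) t)
    (hu : ∀ t, HasDerivAt u (-α * v₀ ^ 2 * |x t| ^ (2 * (α - 1)) * x t) t) (s t : ℝ) :
    u s ^ 2 + v₀ ^ 2 * |x s| ^ (2 * α) = u t ^ 2 + v₀ ^ 2 * |x t| ^ (2 * α) := by
  have hderiv : ∀ r, HasDerivAt (fun r => u r ^ 2 + v₀ ^ 2 * |x r| ^ (2 * α)) 0 r := by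
    intro r
    have hpow : HasDerivAt (fun r => |x r| ^ (2 * α))
        (2 * α * |x r| ^ (2 * α - 2) * x r * u r) r :=
      (hasDerivAt_abs_rpow (x r) (by linarith : 1 < 2 * α)).comp r (hx r)
    refine (((hu r).fun_pow 2).fun_add (hpow.const_mul (v₀ ^ 2))).congr_deriv ?_
    rw [show 2 * (α - 1) = 2 * α - 2 by ring]
    push_cast
    ring
  exact is_const_of_deriv_eq_zero (fun r => (hderiv r).differentiableAt)
    (fun r => (hderiv r).deriv) s t

theorem abs_rpow_mul_mul_self (α : ℝ) (hα : α ≠ 0) (x : ℝ) :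
    |x| ^ (2 * (α - 1)) * x * x = |x| ^ (2 * α) := by
  rcases eq_or_ne x 0 with rfl | h
  · simp [Real.zero_rpow (mul_ne_zero two_ne_zero hα)]
  · rw [mul_assoc, ← abs_mul_abs_self x, ← sq, ← Real.rpow_natCast,
      ← Real.rpow_add (abs_pos.2 h)]
    congr 1
    push_cast
    ring

/-- The explicit formula for the `y`-component of the α-Grushin normal geodesics:
with `2H = u(0)² + v₀² |x(0)|^(2α)` and
`y(t) = y₀ + (2H t + u(0)x(0) - u(t)x(t)) / (v₀ (α+1))`, one has
`y'(t) = v₀ |x(t)|^(2α)`. -/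
theorem alpha_grushin_y_component (α : ℝ) (hα : 1 ≤ α) (v₀ : ℝ) (hv₀ : v₀ ≠ 0)
    (u x : ℝ → ℝ)
    (hx : ∀ t, HasDerivAt x (u t) t)
    (hu : ∀ t, HasDerivAt u (-α * v₀ ^ 2 * |x t| ^ (2 * (α - 1)) * x t) t)
    (y₀ : ℝ) :
    ∀ t : ℝ,
      HasDerivAt
        (fun s => y₀ + (((u 0) ^ 2 + v₀ ^ 2 * |x 0| ^ (2 * α)) * s
            + u 0 * x 0 - u s * x s) / (v₀ * (α + 1)))
        (v₀ * |x t| ^ (2 * α)) t := by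
  intro t
  have hden : v₀ * (α + 1) ≠ 0 := mul_ne_zero hv₀ (by linarith)
  have henergy := alpha_grushin_energy_eq α hα v₀ u x hx hu 0 t
  have hpow := abs_rpow_mul_mul_self α (by linarith) (x t)
  refine ((((((hasDerivAt_id' t).const_mul (u 0 ^ 2 + v₀ ^ 2 * |x 0| ^ (2 * α))).add_const
    (u 0 * x 0)).fun_sub ((hu t).fun_mul (hx t))).div_const (v₀ * (α + 1))).const_add
      y₀).congr_deriv ?_
  rw [div_eq_iff hden]
  linear_combination henergy + α * v₀ ^ 2 * hpow
end

section
/- Let ρ ∈ ℝ with ρ ≠ 0, and let p_{a0}, p_{b0}, p_{c0}, x_{a0}, x_{b0}, x_{c0} ∈ ℝ. Define p_a(t) := p_{a0} cos(ρt) − ((ρ² x_{a0} + p_{c0})/ρ) sin(ρt), p_b(t) := p_{b0}, p_c(t) := p_{c0}, x_a(t) := ((ρ² x_{a0} + p_{c0}) cos(ρt) + ρ p_{a0} sin(ρt) − p_{c0})/ρ², x_b(t) := p_{b0} t + x_{b0}, and x_c(t) := (ρ(ρ² x_{c0} − p_{a0} cos(ρt) + p_{a0} − p_{c0} t) + (ρ²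 x_{a0} + p_{c0}) sin(ρt))/ρ³. Then these functions satisfy the linear system p_a' = −p_c − ρ² x_a, p_b' = 0, p_c' = 0, x_a' = p_a, x_b' = p_b, x_c' = x_a, together with the initial conditions p_a(0) = p_{a0}, p_b(0) = p_{b0}, p_c(0) = p_{c0}, x_a(0) = x_{a0}, x_b(0) = x_{b0}, x_c(0) = x_{c0}. -/
/-- Explicit integration of the Jacobi equation of SU(2) in the canonical frame:
the displayed functions solve `p_a' = -p_c - ρ² x_a`, `p_b' = 0`, `p_c' = 0`,
`x_a' = p_a`, `x_b' = p_b`, `x_c' = x_a` with the given initial conditions. -/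
theorem su2_jacobi_explicit (ρ : ℝ) (hρ : ρ ≠ 0)
    (pa0 pb0 pc0 xa0 xb0 xc0 : ℝ)
    (pa pb pc xa xb xc : ℝ → ℝ)
    (hpa : ∀ t, pa t =
      pa0 * Real.cos (ρ * t) - ((ρ ^ 2 * xa0 + pc0) / ρ) * Real.sin (ρ * t))
    (hpb : ∀ t, pb t = pb0)
    (hpc : ∀ t, pc t = pc0)
    (hxa : ∀ t, xa t =
      ((ρ ^ 2 * xa0 + pc0) * Real.cos (ρ * t) + ρ * pa0 * Real.sin (ρ * t) - pc0) / ρ ^ 2)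
    (hxb : ∀ t, xb t = pb0 * t + xb0)
    (hxc : ∀ t, xc t =
      (ρ * (ρ ^ 2 * xc0 - pa0 * Real.cos (ρ * t) + pa0 - pc0 * t)
        + (ρ ^ 2 * xa0 + pc0) * Real.sin (ρ * t)) / ρ ^ 3) :
    (∀ t, HasDerivAt pa (-(pc t) - ρ ^ 2 * xa t) t) ∧
    (∀ t, HasDerivAt pb 0 t) ∧
    (∀ t, HasDerivAt pc 0 t) ∧
    (∀ t, HasDerivAt xa (pa t) t) ∧
    (∀ t, HasDerivAt xb (pb t) t) ∧
    (∀ t, HasDerivAt xc (xa t) t) ∧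
    pa 0 = pa0 ∧ pb 0 = pb0 ∧ pc 0 = pc0 ∧ xa 0 = xa0 ∧ xb 0 = xb0 ∧ xc 0 = xc0 := by
  have hlin (t : ℝ) : HasDerivAt (fun s : ℝ => ρ * s) ρ t := by
    simpa using (hasDerivAt_id t).const_mul ρ
  have hcos (t : ℝ) := (hlin t).cos
  have hsin (t : ℝ) := (hlin t).sin
  refine ⟨fun t => ?_, fun t => ?_, fun t => ?_, fun t => ?_, fun t => ?_, fun t => ?_,
    ?_, hpb 0, hpc 0, ?_, ?_, ?_⟩
  · rw [funext hpa, hpc, hxa]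
    refine (((hcos t).const_mul pa0).sub
      ((hsin t).const_mul ((ρ ^ 2 * xa0 + pc0) / ρ))).congr_deriv ?_
    field_simp
    ring
  · rw [funext hpb]
    exact hasDerivAt_const t pb0
  · rw [funext hpc]
    exact hasDerivAt_const t pc0
  · rw [funext hxa, hpa]
    refine (((((hcos t).const_mul (ρ ^ 2 * xa0 + pc0)).add
      ((hsin t).const_mul (ρ * pa0))).sub_const pc0).div_const (ρ ^ 2)).congr_deriv ?_
    field_simp
    ring
  · rw [funext hxb, hpb]
    simpa using ((hasDerivAt_id t).const_mul pb0).add_const xb0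
  · rw [funext hxc, hxa]
    refine (((((((hcos t).const_mul pa0).const_sub (ρ ^ 2 * xc0)).add_const pa0).sub
      ((hasDerivAt_id t).const_mul pc0)).const_mul ρ).add
      ((hsin t).const_mul (ρ ^ 2 * xa0 + pc0)) |>.div_const (ρ ^ 3)).congr_deriv ?_
    field_simp
    ring
  · simp [hpa]
  · simp [hxa, hρ]
  · simp [hxb]
  · rw [hxc]
    simp only [mul_zero, Real.cos_zero, Real.sin_zero]
    field_simp
    ring
end

section
/- For every real r ≠ 0, the determinant of the 3×3 real matrix M_r := [[sin(r)/r, 0, (cos(r)−1)/r²], [0, 1, 0], [(1−cos(r))/r², 0, (sin(r)−r)/r³]] equals 2 sin(r/2) (2 sin(r/2) − r cos(r/2)) / r⁴. -/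
/-- The determinant of the conjugate-point matrix `M_r` of SU(2) equals
`2 sin(r/2) (2 sin(r/2) - r cos(r/2)) / r⁴`. -/
theorem su2_conjugate_matrix_det (r : ℝ) (hr : r ≠ 0) :
    (!![Real.sin r / r, 0, (Real.cos r - 1) / r ^ 2;
        0, 1, 0;
        (1 - Real.cos r) / r ^ 2, 0, (Real.sin r - r) / r ^ 3] :
      Matrix (Fin 3) (Fin 3) ℝ).det =
      2 * Real.sin (r / 2) * (2 * Real.sin (r / 2) - r * Real.cos (r / 2)) / r ^ 4 := by
  have hsin : Real.sin r = 2 * Real.sin (r / 2) * Real.cos (r / 2) := by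
    rw [← Real.sin_two_mul, mul_div_cancel₀ r two_ne_zero]
  have hcos : Real.cos r = 1 - 2 * Real.sin (r / 2) ^ 2 := by
    have h := Real.cos_sq' (r / 2)
    have h₂ := Real.cos_two_mul (r / 2)
    rw [mul_div_cancel₀ r two_ne_zero] at h₂
    linear_combination h₂ + 2 * h
  have hpyth := Real.sin_sq_add_cos_sq (r / 2)
  rw [Matrix.det_fin_three]
  simp only [Matrix.of_apply, Matrix.cons_val]
  rw [hsin, hcos]
  field_simp
  linear_combination (4 * Real.sin (r / 2) ^ 2) * hpyth
end

section
/- Let r ∈ ℝ with r ≠ 0, and let M_r := [[sin(r)/r, 0, (cos(r)−1)/r²], [0, 1, 0], [(1−cos(r))/r², 0, (sin(r)−r)/r³]]. Then M_r has a nontrivial kernel if and only if sin(r/2) (r cos(r/2) − 2 sin(r/2)) = 0. Moreover, for every r ≠ 0 the kernel of M_r has dimension at most 1. -/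
/-- The determinant of the conjugate-point matrix of SU(2), in factored form. -/
theorem det_su2_conjugate_matrix {r : ℝ} (hr : r ≠ 0) :
    (!![Real.sin r / r, 0, (Real.cos r - 1) / r ^ 2;
        0, 1, 0;
        (1 - Real.cos r) / r ^ 2, 0, (Real.sin r - r) / r ^ 3] : Matrix (Fin 3) (Fin 3) ℝ).det =
      -2 / r ^ 4 * (Real.sin (r / 2) * (r * Real.cos (r / 2) - 2 * Real.sin (r / 2))) := by
  have hs : Real.sin r = 2 * Real.sin (r / 2) * Real.cos (r / 2) := by
    rw [← Real.sin_two_mul, mul_div_cancel₀ r two_ne_zero]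
  have hc : Real.cos r = 1 - 2 * Real.sin (r / 2) ^ 2 := by
    rw [← Real.cos_two_mul_eq_one_sub, mul_div_cancel₀ r two_ne_zero]
  rw [Matrix.det_fin_three]
  simp only [Matrix.of_apply, Matrix.cons_val]
  rw [hs, hc]
  field_simp
  linear_combination 4 * Real.sin (r / 2) ^ 2 * Real.sin_sq_add_cos_sq (r / 2)

/-- A subspace on which some coordinate is injective has dimension at most one. -/
theorem Submodule.finrank_le_one_of_coord_injective {K ι : Type*} [Field K]
    (p : Submodule K (ι → K)) (i : ι) (h : ∀ v ∈ p, v i = 0 → v = 0) :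
    Module.finrank K p ≤ 1 := by
  have hinj : Function.Injective ((LinearMap.proj i : (ι → K) →ₗ[K] K) ∘ₗ p.subtype) :=
    (injective_iff_map_eq_zero _).2 fun v hv => Subtype.ext (h v v.2 hv)
  simpa using LinearMap.finrank_le_finrank_of_injective hinj


/-- The conjugate-point matrix `M_r` of SU(2) has a nontrivial kernel iff
`sin(r/2)(r cos(r/2) - 2 sin(r/2)) = 0`, and its kernel has dimension at most 1. -/
theorem su2_conjugate_matrix_kernel (r : ℝ) (hr : r ≠ 0)
    (M : Matrix (Fin 3) (Fin 3) ℝ)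
    (hM : M = !![Real.sin r / r, 0, (Real.cos r - 1) / r ^ 2;
                 0, 1, 0;
                 (1 - Real.cos r) / r ^ 2, 0, (Real.sin r - r) / r ^ 3]) :
    ((∃ v : Fin 3 → ℝ, v ≠ 0 ∧ M.mulVec v = 0) ↔
      Real.sin (r / 2) * (r * Real.cos (r / 2) - 2 * Real.sin (r / 2)) = 0) ∧
    Module.finrank ℝ (LinearMap.ker M.mulVecLin) ≤ 1 := by
  subst hM
  constructor
  · rw [Matrix.exists_mulVec_eq_zero_iff, det_su2_conjugate_matrix hr, mul_eq_zero,
      or_iff_right (div_ne_zero (by norm_num) (pow_ne_zero 4 hr))]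
  by_cases hc : Real.cos r = 1
  · have hs : Real.sin r = 0 := Real.sin_eq_zero_iff_cos_eq.2 (Or.inl hc)
    refine Submodule.finrank_le_one_of_coord_injective _ 0 fun v hv h0 => ?_
    rw [LinearMap.mem_ker, Matrix.mulVecLin_apply] at hv
    have h1 := congrFun hv 1
    have h2 := congrFun hv 2
    simp [Matrix.mulVec, dotProduct, Fin.sum_univ_three, hs, hc, hr] at h1 h2
    ext i
    fin_cases i <;> assumption
  · refine Submodule.finrank_le_one_of_coord_injective _ 2 fun v hv h2 => ?_
    rw [LinearMap.mem_ker, Matrix.mulVecLin_apply] at hv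
    have h1 := congrFun hv 1
    have h0 := congrFun hv 2
    simp [Matrix.mulVec, dotProduct, Fin.sum_univ_three, h2, hr, sub_eq_zero, Ne.symm hc] at h1 h0
    ext i
    fin_cases i <;> assumption
end

section
/- Let r ∈ ℝ with r ≠ 0, and let M_r := [[sin(r)/r, 0, (cos(r)−1)/r²], [0, 1, 0], [(1−cos(r))/r², 0, (sin(r)−r)/r³]]. (i) If r = 2kπ for a nonzero integer k, then the kernel of M_r is the line spanned by (1, 0, 0). (ii) If sin(r/2) ≠ 0 and r cos(r/2) = 2 sin(r/2), then the kernel of M_r is the line spanned by (tan(r/2), 0, r). -/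
/-- Membership in the kernel of `M_r`, with denominators cleared. -/
theorem su2_conjugate_matrix_mulVec_eq_zero_iff {r : ℝ} (hr : r ≠ 0) (v : Fin 3 → ℝ) :
    !![Real.sin r / r, 0, (Real.cos r - 1) / r ^ 2;
       0, 1, 0;
       (1 - Real.cos r) / r ^ 2, 0, (Real.sin r - r) / r ^ 3].mulVec v = 0 ↔
    r * Real.sin r * v 0 + (Real.cos r - 1) * v 2 = 0 ∧ v 1 = 0 ∧
      r * (1 - Real.cos r) * v 0 + (Real.sin r - r) * v 2 = 0 := by
  have h₀ : Real.sin r / r * v 0 + (Real.cos r - 1) / r ^ 2 * v 2 =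
      (r * Real.sin r * v 0 + (Real.cos r - 1) * v 2) / r ^ 2 := by
    field_simp
  have h₂ : (1 - Real.cos r) / r ^ 2 * v 0 + (Real.sin r - r) / r ^ 3 * v 2 =
      (r * (1 - Real.cos r) * v 0 + (Real.sin r - r) * v 2) / r ^ 3 := by
    field_simp
  simp [funext_iff, Fin.forall_fin_succ, dotProduct, Fin.sum_univ_succ, h₀, h₂, hr]


/-- The kernel of the conjugate-point matrix `M_r` of SU(2):
(i) if `r = 2kπ` with `k` a nonzero integer, the kernel is spanned by `(1,0,0)`;
(ii) if `sin(r/2) ≠ 0` and `r cos(r/2) = 2 sin(r/2)`, the kernel is spanned by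
`(tan(r/2), 0, r)`. -/
theorem su2_conjugate_matrix_kernel_description (r : ℝ) (hr : r ≠ 0)
    (M : Matrix (Fin 3) (Fin 3) ℝ)
    (hM : M = !![Real.sin r / r, 0, (Real.cos r - 1) / r ^ 2;
                 0, 1, 0;
                 (1 - Real.cos r) / r ^ 2, 0, (Real.sin r - r) / r ^ 3]) :
    ((∃ k : ℤ, k ≠ 0 ∧ r = 2 * k * Real.pi) →
      LinearMap.ker M.mulVecLin = Submodule.span ℝ {![1, 0, 0]}) ∧
    ((Real.sin (r / 2) ≠ 0 ∧ r * Real.cos (r / 2) = 2 * Real.sin (r / 2)) →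
      LinearMap.ker M.mulVecLin = Submodule.span ℝ {![Real.tan (r / 2), 0, r]}) := by
  subst hM
  refine ⟨?_, ?_⟩
  · rintro ⟨k, -, hk⟩
    have hsin : Real.sin r = 0 := by
      rw [hk, show 2 * (k : ℝ) * Real.pi = k * (2 * Real.pi) by ring]
      simpa using Real.sin_add_int_mul_two_pi 0 k
    have hcos : Real.cos r = 1 := by
      rw [hk, show 2 * (k : ℝ) * Real.pi = k * (2 * Real.pi) by ring]
      exact Real.cos_int_mul_two_pi k
    ext v
    rw [LinearMap.mem_ker, Matrix.mulVecLin_apply, su2_conjugate_matrix_mulVec_eq_zero_iff hr,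
      Submodule.mem_span_singleton, hsin, hcos]
    constructor
    · rintro ⟨-, h₁, h₂⟩
      have hv : v 2 = 0 := by simpa [hr] using h₂
      exact ⟨v 0, by ext i; fin_cases i <;> simp [h₁, hv]⟩
    · rintro ⟨a, rfl⟩
      simp
  · rintro ⟨hs, h⟩
    have hc : Real.cos (r / 2) ≠ 0 := by
      intro hc
      rw [hc, mul_zero] at h
      exact hs (by linarith)
    have htan : Real.tan (r / 2) = r / 2 := by
      rw [Real.tan_eq_sin_div_cos, div_eq_iff hc]
      linarith
    have hsin : Real.sin r = 2 * Real.sin (r / 2) * Real.cos (r / 2) := by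
      rw [← Real.sin_two_mul, mul_div_cancel₀ r two_ne_zero]
    have hcos : Real.cos r = 1 - 2 * Real.sin (r / 2) ^ 2 := by
      rw [← Real.cos_two_mul_eq_one_sub, mul_div_cancel₀ r two_ne_zero]
    ext v
    rw [LinearMap.mem_ker, Matrix.mulVecLin_apply, su2_conjugate_matrix_mulVec_eq_zero_iff hr,
      Submodule.mem_span_singleton, htan, hsin, hcos]
    constructor
    · rintro ⟨h₀, h₁, -⟩
      have hv : v 2 = 2 * v 0 := by
        have : 2 * Real.sin (r / 2) ^ 2 * (2 * v 0 - v 2) = 0 := by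
          linear_combination h₀ - 2 * Real.sin (r / 2) * v 0 * h
        have := (mul_eq_zero.mp this).resolve_left (by positivity)
        linarith
      refine ⟨v 2 / r, ?_⟩
      ext i
      fin_cases i
      · simp [hv]
        field_simp
      · simp [h₁]
      · simp [hr]
    · rintro ⟨a, rfl⟩
      have hp := Real.sin_sq_add_cos_sq (r / 2)
      simp
      constructor
      · linear_combination a * r * Real.sin (r / 2) * h
      · linear_combination a * r * r * hp - a * r * Real.cos (r / 2) * h
end

section
/- Define f₀ : ℝ³ → ℝ by f₀(λ) := ‖λ‖ cos(‖λ‖/2) − 2 sin(‖λ‖/2), where ‖·‖ is the Euclidean norm. For every λ ∈ ℝ³ with λ ≠ 0, f₀ is Fréchet differentiable at λ with derivative the linear map v ↦ −(1/2) sin(‖λ‖/2) ⟨λ, v⟩ (Euclidean inner product). Moreover, if in addition f₀(λ) = 0, then this derivative is a nonzero linear functional; hence 0 is a regular value of the restriction of f₀ to ℝ³ \ {0}. -/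
/-- Away from the origin, the norm of a real inner product space has derivative
`v ↦ ‖x‖⁻¹ ⟪x, v⟫`. -/
theorem hasFDerivAt_norm_of_ne_zero {E : Type*} [NormedAddCommGroup E] [InnerProductSpace ℝ E]
    {x : E} (hx : x ≠ 0) : HasFDerivAt (fun y : E => ‖y‖) (‖x‖⁻¹ • innerSL ℝ x) x := by
  have h := (hasStrictFDerivAt_norm_sq x).hasFDerivAt.sqrt (by simpa using hx)
  simp only [Real.sqrt_sq (norm_nonneg _)] at h
  convert h using 1
  ext v
  simp
  ring

/-- The derivative of `r cos (r / 2) - 2 sin (r / 2)`. -/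
theorem hasDerivAt_mul_cos_half_sub_two_mul_sin_half (r : ℝ) :
    HasDerivAt (fun r : ℝ => r * Real.cos (r / 2) - 2 * Real.sin (r / 2))
      (-(1 / 2) * Real.sin (r / 2) * r) r := by
  have h2 : HasDerivAt (fun r : ℝ => r / 2) (1 / 2) r := (hasDerivAt_id r).div_const 2
  refine (((hasDerivAt_id' r).mul h2.cos).sub (h2.sin.const_mul 2)).congr_deriv ?_
  ring

/-- The function `f₀(λ) = ‖λ‖ cos(‖λ‖/2) - 2 sin(‖λ‖/2)` on ℝ³ is Fréchet
differentiable away from the origin with derivative `v ↦ -(1/2) sin(‖λ‖/2) ⟪λ, v⟫`,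
which is nonzero whenever `f₀(λ) = 0`: hence `0` is a regular value of `f₀` on ℝ³∖{0}. -/
theorem su2_C0_regular_value :
    ∀ lam : EuclideanSpace ℝ (Fin 3), lam ≠ 0 →
      HasFDerivAt
        (fun μ : EuclideanSpace ℝ (Fin 3) =>
          ‖μ‖ * Real.cos (‖μ‖ / 2) - 2 * Real.sin (‖μ‖ / 2))
        ((-(1 / 2) * Real.sin (‖lam‖ / 2)) • (innerSL ℝ lam)) lam ∧
      (‖lam‖ * Real.cos (‖lam‖ / 2) - 2 * Real.sin (‖lam‖ / 2) = 0 →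
        (-(1 / 2) * Real.sin (‖lam‖ / 2)) • (innerSL ℝ lam) ≠ 0) := by
  intro lam hlam
  have hr : ‖lam‖ ≠ 0 := norm_ne_zero_iff.mpr hlam
  refine ⟨?_, fun h0 => smul_ne_zero (mul_ne_zero (by norm_num) fun hs => ?_) fun h => ?_⟩
  · have h := (hasDerivAt_mul_cos_half_sub_two_mul_sin_half ‖lam‖).comp_hasFDerivAt lam
      (hasFDerivAt_norm_of_ne_zero hlam)
    rw [smul_smul, mul_assoc _ ‖lam‖, mul_inv_cancel₀ hr, mul_one] at h
    exact h
  · have hc : Real.cos (‖lam‖ / 2) = 0 := by simpa [hs, hr] using h0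
    simpa [hs, hc] using Real.sin_sq_add_cos_sq (‖lam‖ / 2)
  · exact hlam (by simpa using DFunLike.congr_fun h lam)
end

section
/- Let λ₀ = (u₀, v₀, w₀) ∈ ℝ³ with λ₀ ≠ 0, set ρ := ‖λ₀‖ (Euclidean norm), and assume ρ cos(ρ/2) − 2 sin(ρ/2) = 0 and w₀ ≠ 0. Let K := ρ cos(ρ/2)·(−v₀, u₀, 0) + 4 sin(ρ/2)·(0, 0, 1) ∈ ℝ³. Then −(1/2) sin(ρ/2) ⟨λ₀, K⟩ = −2 w₀ sin²(ρ/2), and this quantity is nonzero. In particular, the derivative of f₀(λ) = ‖λ‖ cos(‖λ‖/2) − 2 sin(‖λ‖/2) at λ₀ does not vanish on K. -/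
/-- Transversality at a fold point of SU(2): for a conjugate covector
`λ₀ = (u₀, v₀, w₀)` in the stratum `C⁰` (so `ρ cos(ρ/2) = 2 sin(ρ/2)`, `ρ = ‖λ₀‖`)
with `w₀ ≠ 0`, the derivative of `f₀` does not vanish on the kernel direction
`K = ρ cos(ρ/2)(-v₀, u₀, 0) + 4 sin(ρ/2)(0,0,1)`:
`-(1/2) sin(ρ/2) ⟨λ₀, K⟩ = -2 w₀ sin²(ρ/2) ≠ 0`. -/
theorem su2_fold_transversality (u₀ v₀ w₀ ρ : ℝ)
    (hρ : ρ = Real.sqrt (u₀ ^ 2 + v₀ ^ 2 + w₀ ^ 2))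
    (hne : ¬(u₀ = 0 ∧ v₀ = 0 ∧ w₀ = 0))
    (h0 : ρ * Real.cos (ρ / 2) - 2 * Real.sin (ρ / 2) = 0)
    (hw : w₀ ≠ 0) :
    -(1 / 2) * Real.sin (ρ / 2) *
        (u₀ * (ρ * Real.cos (ρ / 2) * (-v₀)) + v₀ * (ρ * Real.cos (ρ / 2) * u₀)
          + w₀ * (4 * Real.sin (ρ / 2)))
      = -2 * w₀ * Real.sin (ρ / 2) ^ 2 ∧
    -2 * w₀ * Real.sin (ρ / 2) ^ 2 ≠ 0 := by
  have hpos : 0 < ρ := by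
    rw [hρ]
    positivity
  have hsin : Real.sin (ρ / 2) ≠ 0 := by
    intro hs
    have hcos : Real.cos (ρ / 2) = 0 := by
      rw [hs, mul_zero, sub_zero] at h0
      exact (mul_eq_zero.mp h0).resolve_left hpos.ne'
    simpa [hs, hcos] using Real.sin_sq_add_cos_sq (ρ / 2)
  exact ⟨by ring, mul_ne_zero (mul_ne_zero (by norm_num) hw) (pow_ne_zero 2 hsin)⟩
end

section
/- Let r ∈ ℝ with r < 0 and set q := √(−r). Then the 3×3 real matrix N_r := [[sinh(q)/q, 0, (cosh(q)−1)/r], [0, 1, 0], [(1−cosh(q))/r, 0, (sinh(q)/q − 1)/r]] has determinant 2 sinh(q/2) (q cosh(q/2) − 2 sinh(q/2)) / q⁴, which is strictly positive; in particular N_r is invertible and has trivial kernel. -/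
/-- For positive `x`, `sinh x < x * cosh x` (equivalently, `tanh x < x`). -/
theorem Real.sinh_lt_self_mul_cosh {x : ℝ} (hx : 0 < x) : Real.sinh x < x * Real.cosh x := by
  have hd (y : ℝ) :
      HasDerivAt (fun y ↦ y * Real.cosh y - Real.sinh y) (y * Real.sinh y) y := by
    refine (((hasDerivAt_id' y).mul (Real.hasDerivAt_cosh y)).sub
      (Real.hasDerivAt_sinh y)).congr_deriv ?_
    ring
  have hmono : StrictMonoOn (fun y ↦ y * Real.cosh y - Real.sinh y) (Set.Ici 0) := by
    refine strictMonoOn_of_deriv_pos (convex_Ici 0)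
      (fun y _ ↦ (hd y).continuousAt.continuousWithinAt) fun y hy ↦ ?_
    rw [interior_Ici, Set.mem_Ioi] at hy
    rw [(hd y).deriv]
    exact mul_pos hy (Real.sinh_pos_iff.mpr hy)
  simpa using hmono Set.self_mem_Ici hx.le hx


/-- Covectors of SL(2) with `r_{λ₀} < 0` are never conjugate: for `r < 0` and
`q = √(-r)`, the matrix `N_r` has determinant
`2 sinh(q/2)(q cosh(q/2) - 2 sinh(q/2))/q⁴ > 0`; in particular it is invertible
with trivial kernel. -/
theorem sl2_negative_r_not_conjugate (r : ℝ) (hr : r < 0) (q : ℝ)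
    (hq : q = Real.sqrt (-r))
    (N : Matrix (Fin 3) (Fin 3) ℝ)
    (hN : N = !![Real.sinh q / q, 0, (Real.cosh q - 1) / r;
                 0, 1, 0;
                 (1 - Real.cosh q) / r, 0, (Real.sinh q / q - 1) / r]) :
    N.det = 2 * Real.sinh (q / 2) * (q * Real.cosh (q / 2) - 2 * Real.sinh (q / 2)) / q ^ 4 ∧
    0 < 2 * Real.sinh (q / 2) * (q * Real.cosh (q / 2) - 2 * Real.sinh (q / 2)) / q ^ 4 ∧
    IsUnit N.det ∧
    LinearMap.ker N.mulVecLin = ⊥ := by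
  have hq_pos : 0 < q := hq ▸ Real.sqrt_pos.mpr (neg_pos.mpr hr)
  have hr_eq : r = -q ^ 2 := by
    rw [hq, Real.sq_sqrt (neg_nonneg.mpr hr.le), neg_neg]
  have hdet : N.det =
      2 * Real.sinh (q / 2) * (q * Real.cosh (q / 2) - 2 * Real.sinh (q / 2)) / q ^ 4 := by
    have hsinh : Real.sinh q = 2 * Real.sinh (q / 2) * Real.cosh (q / 2) := by
      rw [← Real.sinh_two_mul, mul_div_cancel₀ q two_ne_zero]
    have hcosh : Real.cosh q = 1 + 2 * Real.sinh (q / 2) ^ 2 := by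
      have h := Real.cosh_two_mul (q / 2)
      rw [mul_div_cancel₀ q two_ne_zero, Real.cosh_sq] at h
      linarith
    rw [hN, Matrix.det_fin_three, hr_eq, hsinh, hcosh]
    simp
    field_simp
    linear_combination -2 * Real.sinh (q / 2) * Real.cosh_sq (q / 2)
  have hpos :
      0 < 2 * Real.sinh (q / 2) * (q * Real.cosh (q / 2) - 2 * Real.sinh (q / 2)) / q ^ 4 := by
    have hs : 0 < Real.sinh (q / 2) := Real.sinh_pos_iff.mpr (half_pos hq_pos)
    have hsc := Real.sinh_lt_self_mul_cosh (half_pos hq_pos)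
    have : 0 < q * Real.cosh (q / 2) - 2 * Real.sinh (q / 2) := by linarith
    positivity
  have hunit : IsUnit N.det := (hdet ▸ hpos).ne'.isUnit
  refine ⟨hdet, hpos, hunit, LinearMap.ker_eq_bot.mpr ?_⟩
  exact Matrix.mulVec_injective_of_isUnit ((Matrix.isUnit_iff_isUnit_det N).mpr hunit)
end

section
/- Let r ∈ ℝ with r ≠ 0, and let s, c : ℝ → ℝ be differentiable functions with s(0) = 0, c(0) = 1, s' = c, and c' = −r·s. Let p_{a0}, p_{b0}, p_{c0}, x_{a0}, x_{b0}, x_{c0} ∈ ℝ, and define p_a(t) := p_{a0} c(t) − (r x_{a0} + p_{c0}) s(t), p_b(t) := p_{b0}, p_c(t) := p_{c0}, x_a(t) := ((r x_{a0} + p_{c0}) c(t) − p_{c0})/r + p_{a0} s(t), x_b(t) := p_{b0} t + x_{b0}, and x_c(t) := x_{c0} + (p_{a0}(1 − c(t)) − p_{c0} t + (r x_{a0} + p_{c0}) s(t))/r. Then these functions satisfy p_a' = −p_c − r x_a, p_b' = 0, p_c' = 0, x_a' = p_a, x_b' = p_b, x_c' = x_a, together with the initial conditions p_a(0) = p_{a0},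 p_b(0) = p_{b0}, p_c(0) = p_{c0}, x_a(0) = x_{a0}, x_b(0) = x_{b0}, x_c(0) = x_{c0}. -/
/-- Explicit integration of the Jacobi equation of SL(2) in the canonical frame:
with `s, c` the generalized sine and cosine (`s 0 = 0`, `c 0 = 1`, `s' = c`,
`c' = -r s`), the displayed functions solve `p_a' = -p_c - r x_a`, `p_b' = 0`,
`p_c' = 0`, `x_a' = p_a`, `x_b' = p_b`, `x_c' = x_a` with the given initial
conditions. -/
theorem sl2_jacobi_explicit (r : ℝ) (hr : r ≠ 0) (s c : ℝ → ℝ)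
    (hs0 : s 0 = 0) (hc0 : c 0 = 1)
    (hs : ∀ t, HasDerivAt s (c t) t)
    (hc : ∀ t, HasDerivAt c (-r * s t) t)
    (pa0 pb0 pc0 xa0 xb0 xc0 : ℝ)
    (pa pb pc xa xb xc : ℝ → ℝ)
    (hpa : ∀ t, pa t = pa0 * c t - (r * xa0 + pc0) * s t)
    (hpb : ∀ t, pb t = pb0)
    (hpc : ∀ t, pc t = pc0)
    (hxa : ∀ t, xa t = ((r * xa0 + pc0) * c t - pc0) / r + pa0 * s t)
    (hxb : ∀ t, xb t = pb0 * t + xb0)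
    (hxc : ∀ t, xc t = xc0 + (pa0 * (1 - c t) - pc0 * t + (r * xa0 + pc0) * s t) / r) :
    (∀ t, HasDerivAt pa (-(pc t) - r * xa t) t) ∧
    (∀ t, HasDerivAt pb 0 t) ∧
    (∀ t, HasDerivAt pc 0 t) ∧
    (∀ t, HasDerivAt xa (pa t) t) ∧
    (∀ t, HasDerivAt xb (pb t) t) ∧
    (∀ t, HasDerivAt xc (xa t) t) ∧
    pa 0 = pa0 ∧ pb 0 = pb0 ∧ pc 0 = pc0 ∧ xa 0 = xa0 ∧ xb 0 = xb0 ∧ xc 0 = xc0 := by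
  obtain rfl : pa = _ := funext hpa
  obtain rfl : pb = _ := funext hpb
  obtain rfl : pc = _ := funext hpc
  obtain rfl : xa = _ := funext hxa
  obtain rfl : xb = _ := funext hxb
  obtain rfl : xc = _ := funext hxc
  refine ⟨fun t ↦ ?_, fun t ↦ hasDerivAt_const t pb0, fun t ↦ hasDerivAt_const t pc0,
    fun t ↦ ?_, fun t ↦ ?_, fun t ↦ ?_, ?_, rfl, rfl, ?_, ?_, ?_⟩
  · refine (((hc t).const_mul pa0).sub ((hs t).const_mul (r * xa0 + pc0))).congr_deriv ?_
    field_simp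
    ring
  · refine (((((hc t).const_mul (r * xa0 + pc0)).sub_const pc0).div_const r).add
      ((hs t).const_mul pa0)).congr_deriv ?_
    field_simp
    ring
  · simpa using ((hasDerivAt_id t).const_mul pb0).add_const xb0
  · refine (((((((hc t).const_sub 1).const_mul pa0).sub
      ((hasDerivAt_id t).const_mul pc0)).add
      ((hs t).const_mul (r * xa0 + pc0))).div_const r).const_add xc0).congr_deriv ?_
    field_simp
    ring
  · simp [hs0, hc0]
  · simp [hs0, hc0, hr]
  · simp
  · simp [hs0, hc0]
end

section
/- Let r ∈ ℝ with r > 0, and let P_r be the 3×3 real matrix [[sin(√r)/√r, 0, (cos(√r)−1)/r], [0, 1, 0], [(1−cos(√r))/r, 0, (sin(√r)/√r − 1)/r]]. Then P_r has a nontrivial kernel if and only if sin(√r/2) (√r cos(√r/2) − 2 sin(√r/2)) = 0. Moreover, for every r > 0 the kernel of P_r has dimension at most 1. -/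
/-- The conjugate-point matrix `P_r` of SL(2) (for `r > 0`) has a nontrivial kernel
iff `sin(√r/2)(√r cos(√r/2) - 2 sin(√r/2)) = 0`, and its kernel has dimension at
most 1 (every conjugate covector of SL(2) has order one). -/
theorem sl2_conjugate_matrix_kernel (r : ℝ) (hr : 0 < r)
    (P : Matrix (Fin 3) (Fin 3) ℝ)
    (hP : P = !![Real.sin (Real.sqrt r) / Real.sqrt r, 0, (Real.cos (Real.sqrt r) - 1) / r;
                 0, 1, 0;
                 (1 - Real.cos (Real.sqrt r)) / r, 0, (Real.sin (Real.sqrt r) / Real.sqrt r - 1) / r]) :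
    ((∃ v : Fin 3 → ℝ, v ≠ 0 ∧ P.mulVec v = 0) ↔
      Real.sin (Real.sqrt r / 2) *
        (Real.sqrt r * Real.cos (Real.sqrt r / 2) - 2 * Real.sin (Real.sqrt r / 2)) = 0) ∧
    Module.finrank ℝ (LinearMap.ker P.mulVecLin) ≤ 1 := by
  subst hP
  obtain ⟨s, hs, rfl⟩ : ∃ s : ℝ, 0 < s ∧ r = s ^ 2 :=
    ⟨√r, Real.sqrt_pos.2 hr, (Real.sq_sqrt hr.le).symm⟩
  rw [Real.sqrt_sq hs.le]
  have hs0 : s ≠ 0 := hs.ne'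
  constructor
  · rw [Matrix.exists_mulVec_eq_zero_iff]
    have hsin : Real.sin s = 2 * Real.sin (s / 2) * Real.cos (s / 2) := by
      rw [← Real.sin_two_mul, mul_div_cancel₀ s two_ne_zero]
    have hcos : Real.cos s = 1 - 2 * Real.sin (s / 2) ^ 2 := by
      rw [← Real.cos_two_mul_eq_one_sub, mul_div_cancel₀ s two_ne_zero]
    have hdet : Matrix.det !![Real.sin s / s, 0, (Real.cos s - 1) / s ^ 2;
        0, 1, 0;
        (1 - Real.cos s) / s ^ 2, 0, (Real.sin s / s - 1) / s ^ 2] =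
        -2 / s ^ 4 * (Real.sin (s / 2) *
          (s * Real.cos (s / 2) - 2 * Real.sin (s / 2))) := by
      rw [Matrix.det_fin_three]
      simp only [Matrix.of_apply, Matrix.cons_val]
      rw [hsin, hcos]
      field_simp
      linear_combination 4 * Real.sin (s / 2) ^ 2 * Real.sin_sq_add_cos_sq (s / 2)
    rw [hdet, mul_eq_zero, or_iff_right (by positivity)]
  · generalize Real.sin s / s = a
    generalize (Real.cos s - 1) / s ^ 2 = b
    generalize (1 - Real.cos s) / s ^ 2 = c
    have hker : ∀ v ∈ LinearMap.ker
        (!![a, 0, b; 0, 1, 0; c, 0, (a - 1) / s ^ 2] : Matrix (Fin 3) (Fin 3) ℝ).mulVecLin,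
        a * v 0 + b * v 2 = 0 ∧ v 1 = 0 ∧ c * v 0 + (a - 1) / s ^ 2 * v 2 = 0 := by
      intro v hv
      rw [LinearMap.mem_ker, Matrix.mulVecLin_apply] at hv
      have h0 := congrFun hv 0
      have h1 := congrFun hv 1
      have h2 := congrFun hv 2
      simp [Matrix.mulVec, dotProduct, Fin.sum_univ_three] at h0 h1 h2
      exact ⟨h0, h1, h2⟩
    have hspan : ∃ w : Fin 3 → ℝ, LinearMap.ker
        (!![a, 0, b; 0, 1, 0; c, 0, (a - 1) / s ^ 2] : Matrix (Fin 3) (Fin 3) ℝ).mulVecLin ≤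
        Submodule.span ℝ {w} := by
      by_cases h : a = 0
      · refine ⟨![1, 0, c * s ^ 2], fun v hv => Submodule.mem_span_singleton.2 ⟨v 0, ?_⟩⟩
        obtain ⟨-, h1, h2⟩ := hker v hv
        rw [h] at h2
        field_simp at h2
        ext i
        fin_cases i
        · simp
        · simp [h1]
        · simp
          linarith
      · refine ⟨![-b / a, 0, 1], fun v hv => Submodule.mem_span_singleton.2 ⟨v 2, ?_⟩⟩
        obtain ⟨h0, h1, -⟩ := hker v hv
        ext i
        fin_cases i
        · simp
          field_simp
          linarith
        · simp [h1]
        · simp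
    obtain ⟨w, hw⟩ := hspan
    exact (Submodule.finrank_mono hw).trans
      (by simpa using finrank_span_le_card (R := ℝ) ({w} : Set (Fin 3 → ℝ)))
end
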